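/- (Optimality, out-of-sample-cost version.) Under the general setting with Assumption 1, and with G_c(x,z) := max_{θ∈Θ} { c(x,θ) − ℓ⁻¹(I_θ(z) − r) } and u_c*(z) := min_{x∈X} G_c(x,z): for any continuous functions X : Z → X and u : Z → ℝ satisfying sup_{z∈Z} { ℓ( c(X(z), θ) − u(z) ) − I_θ(z) } ≤ −r for every θ ∈ Θ, it holds that u_c*(z) ≤ u(z) for every z ∈ Z. -/

import Mathlib

open Filter Topology Set
open scoped ENNReal Classical

noncomputable section

/-- The inner expression `c(x,θ) − ℓ⁻¹(I_θ(z) − r)` as an extended real number,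
with the convention that it equals `−∞` whenever `I_θ(z) = ∞`. -/
def innerC {E Θ Z : Type*} (c : E → Θ → ℝ) (linv : ℝ → ℝ) (r : ℝ)
    (I : Θ → Z → ℝ≥0∞) (x : E) (θ : Θ) (z : Z) : EReal :=
  if I θ z = ∞ then ⊥
  else ((c x θ - linv ((I θ z).toReal - r) : ℝ) : EReal)

/-- `G_c(x,z) := max_{θ∈Θ} { c(x,θ) − ℓ⁻¹(I_θ(z) − r) }` as a real number. -/
def GcFn {E Θ Z : Type*} (c : E → Θ → ℝ) (linv : ℝ → ℝ) (r : ℝ)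
    (I : Θ → Z → ℝ≥0∞) (x : E) (z : Z) : ℝ :=
  (⨆ θ : Θ, innerC c linv r I x θ z).toReal

/-- `u_c*(z) := min_{x∈X} G_c(x,z)`. -/
def ucstarFn {E Θ Z : Type*} (c : E → Θ → ℝ) (X : Set E) (linv : ℝ → ℝ) (r : ℝ)
    (I : Θ → Z → ℝ≥0∞) (z : Z) : ℝ :=
  sInf ((fun x => GcFn c linv r I x z) '' X)

/-- The value `G_c(x,z)` is bounded below by any single finite inner term, or by `0` when the
supremum is infinite. -/
theorem min_zero_le_GcFn {E Θ Z : Type*} (c : E → Θ → ℝ) (linv : ℝ → ℝ) (r : ℝ)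
    (I : Θ → Z → ℝ≥0∞) (x : E) {θ : Θ} {z : Z} (hθ : I θ z ≠ ∞) :
    min 0 (c x θ - linv ((I θ z).toReal - r)) ≤ GcFn c linv r I x z := by
  have hle : ((c x θ - linv ((I θ z).toReal - r) : ℝ) : EReal) ≤
      ⨆ θ : Θ, innerC c linv r I x θ z := by
    simpa [innerC, hθ] using le_iSup (fun θ => innerC c linv r I x θ z) θ
  unfold GcFn
  by_cases htop : (⨆ θ : Θ, innerC c linv r I x θ z) = ⊤
  · simp [htop]
  · exact (min_le_right _ _).trans
      (EReal.toReal_le_toReal hle (EReal.coe_ne_bot _) htop)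

/-- A uniform upper bound on the finite inner terms is an upper bound on `G_c(x,z)`. -/
theorem GcFn_le {E Θ Z : Type*} {c : E → Θ → ℝ} {linv : ℝ → ℝ} {r : ℝ}
    {I : Θ → Z → ℝ≥0∞} {x : E} {z : Z} {b : ℝ} (hfin : ∃ θ, I θ z ≠ ∞)
    (hb : ∀ θ, I θ z ≠ ∞ → c x θ - linv ((I θ z).toReal - r) ≤ b) :
    GcFn c linv r I x z ≤ b := by
  obtain ⟨θ₀, hθ₀⟩ := hfin
  have hle : (⨆ θ : Θ, innerC c linv r I x θ z) ≤ (b : EReal) := by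
    refine iSup_le fun θ => ?_
    by_cases hθ : I θ z = ∞
    · simp [innerC, hθ]
    · simpa only [innerC, hθ, if_false, EReal.coe_le_coe_iff] using hb θ hθ
  have hbot : (⨆ θ : Θ, innerC c linv r I x θ z) ≠ ⊥ := by
    refine ne_bot_of_le_ne_bot ?_ (le_iSup (fun θ => innerC c linv r I x θ z) θ₀)
    simp only [innerC, hθ₀, if_false]
    exact EReal.coe_ne_bot _
  exact EReal.toReal_le_toReal hle hbot (EReal.coe_ne_top b)

/-- optimality, out-of-sample-cost version: if continuous `X : Z → X` and
`u : Z → ℝ` satisfy `sup_{z∈Z} { ℓ(c(X(z),θ) − u(z)) − I_θ(z) } ≤ −r` for every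
`θ ∈ Θ`, then `u_c*(z) ≤ u(z)` for every `z ∈ Z`. -/
theorem ucstar_pareto_dominant_cost
    {E Θ Z : Type*} [NormedAddCommGroup E] [NormedSpace ℝ E]
    [MetricSpace Θ] [CompactSpace Θ] [Nonempty Θ]
    [MetricSpace Z] [Nonempty Z]
    (X : Set E) (hXcomp : IsCompact X) (hXconv : Convex ℝ X) (hXne : X.Nonempty)
    (c : E → Θ → ℝ)
    (hc : ContinuousOn (fun p : E × Θ => c p.1 p.2) (X ×ˢ univ))
    (hcconv : ∀ θ : Θ, StrictConvexOn ℝ X fun x => c x θ)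
    (ℓ : ℝ → ℝ) (hℓcont : Continuous ℓ) (hℓmono : StrictMono ℓ)
    (hℓbij : Function.Bijective ℓ) (hℓ0 : ℓ 0 = 0)
    (linv : ℝ → ℝ) (hlinv : ∀ y, ℓ (linv y) = y) (hlinv' : ∀ y, linv (ℓ y) = y)
    (r : ℝ) (hr : 0 < r)
    (I : Θ → Z → ℝ≥0∞)
    (hI1 : ∀ z : Z, ∃ θ : Θ, I θ z ≠ ∞)
    (hI2 : LowerSemicontinuous fun p : Θ × Z => I p.1 p.2)
    (hI3 : ∀ (θ : Θ) (z : Z), I θ z ≠ ∞ → ∀ zs : ℕ → Z, Tendsto zs atTop (𝓝 z) →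
      ∃ θs : ℕ → Θ, Tendsto θs atTop (𝓝 θ) ∧
        Tendsto (fun n => I (θs n) (zs n)) atTop (𝓝 (I θ z)))
    (Xf : Z → E) (hXfcont : Continuous Xf) (hXfmem : ∀ z : Z, Xf z ∈ X)
    (u : Z → ℝ) (hucont : Continuous u)
    (hfeas : ∀ θ : Θ,
      (⨆ z : Z, if I θ z = ∞ then (⊥ : EReal)
        else ((ℓ (c (Xf z) θ - u z) - (I θ z).toReal : ℝ) : EReal))
        ≤ ((-r : ℝ) : EReal)) :
    ∀ z : Z, ucstarFn c X linv r I z ≤ u z := by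
  intro z
  have hG : GcFn c linv r I (Xf z) z ≤ u z := by
    refine GcFn_le (hI1 z) fun θ hθ => ?_
    have hz := (le_iSup (fun z : Z => if I θ z = ∞ then (⊥ : EReal)
      else ((ℓ (c (Xf z) θ - u z) - (I θ z).toReal : ℝ) : EReal)) z).trans (hfeas θ)
    simp only [hθ, if_false, EReal.coe_le_coe_iff] at hz
    have hℓ : ℓ (c (Xf z) θ - u z) ≤ ℓ (linv ((I θ z).toReal - r)) := by
      rw [hlinv]
      linarith
    linarith [hℓmono.le_iff_le.mp hℓ]
  obtain ⟨θ₀, hθ₀⟩ := hI1 z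
  have hcθ₀ : ContinuousOn (fun x => c x θ₀) X :=
    hc.comp (f := fun x : E => (x, θ₀)) (by fun_prop) fun x hx => ⟨hx, mem_univ _⟩
  obtain ⟨m, hm⟩ := hXcomp.bddBelow_image hcθ₀
  have hbdd : BddBelow ((fun x => GcFn c linv r I x z) '' X) := by
    refine ⟨min 0 (m - linv ((I θ₀ z).toReal - r)), ?_⟩
    rintro _ ⟨x, hx, rfl⟩
    exact (min_le_min_left 0 (sub_le_sub_right (hm (mem_image_of_mem _ hx)) _)).trans
      (min_zero_le_GcFn c linv r I x hθ₀)
  exact (csInf_le hbdd (mem_image_of_mem _ (hXfmem z))).trans hG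

end
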